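/- (Key lower bound from the proof of the consistency theorem, unequal lengths.) Suppose 0 < c(m) ≤ c_max for all m ∈ M and let γ ≥ 1. Let p⁺ be an interpretable path of length K⁺ ending at model m⁺, and let p⁻ be an interpretable path of length K⁻ ending at model m⁻ with K⁻ > K⁺. Then ℒ_γ(p⁻) − ℒ_γ(p⁺) ≥ γ^{K⁺} · ( γ·c(m⁻) − c(m⁺) − c_max · ∑_{k=1}^{K⁺−1} γ^{k−K⁺} ). -/

import Mathlib

variable {M : Type*}

/-- `p` is an interpretable path from the base model `m₀` under step neighborhoods `S`:
`m₁ ∈ S m₀` and `m_{k+1} ∈ S m_k`.  The empty list is the (unique) path of length 0. -/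
def IsPath (S : M → Set M) (m₀ : M) (p : List M) : Prop :=
  List.Chain (fun a b => b ∈ S a) m₀ p

/-- The cost sequence of a path `p = (m_1, …, m_K)`: `costSeq c p k = c m_k` for `1 ≤ k ≤ K`
and `0` otherwise (in particular the value at the unused index `0` is `0`). -/
def costSeq (c : M → ℝ) (p : List M) : ℕ → ℝ :=
  fun k => ((0 : ℝ) :: p.map c).getD k 0

/-- Weighted-sum path interpretability loss `ℒ_α(p) = ∑_{k=1}^{|p|} α_k c(m_k)`. -/
noncomputable def wLoss (c : M → ℝ) (α : ℕ → ℝ) (p : List M) : ℝ :=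
  ∑ k ∈ Finset.Icc 1 p.length, α k * costSeq c p k

/-- Path interpretability loss `ℒ_γ(p) = ∑_{k=1}^{|p|} γ^k c(m_k)`. -/
noncomputable def gLoss (c : M → ℝ) (γ : ℝ) (p : List M) : ℝ :=
  ∑ k ∈ Finset.Icc 1 p.length, γ ^ k * costSeq c p k

/-- Model interpretability loss `ℒ_γ(m) = inf_{p ∈ 𝒫(m)} ℒ_γ(p)`. -/
noncomputable def modelLoss (c : M → ℝ) (S : M → Set M) (m₀ : M) (γ : ℝ) (m : M) : ℝ :=
  sInf (gLoss c γ '' {p | IsPath S m₀ p ∧ p.getLastD m₀ = m})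

/-- Model interpretability loss for general weights `α`. -/
noncomputable def modelWLoss (c : M → ℝ) (S : M → Set M) (m₀ : M) (α : ℕ → ℝ) (m : M) : ℝ :=
  sInf (wLoss c α '' {p | IsPath S m₀ p ∧ p.getLastD m₀ = m})

/-- Model complexity: the minimal length of an interpretable path leading to `m`. -/
noncomputable def modelComplexity (S : M → Set M) (m₀ : M) (m : M) : ℕ :=
  sInf (List.length '' {p | IsPath S m₀ p ∧ p.getLastD m₀ = m})

/-- Lexicographic order on real sequences: `u ≼ v` iff `u = v` or `u_K < v_K` at the first
index `K` at which `u` and `v` differ. -/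
def lexLE (u v : ℕ → ℝ) : Prop :=
  u = v ∨ ∃ K : ℕ, (∀ k < K, u k = v k) ∧ u K < v K

theorem costSeq_nonneg_aux (c : M → ℝ) (hc : ∀ m, 0 < c m) (p : List M) (k : ℕ) :
    0 ≤ costSeq c p k := by
  unfold costSeq
  rcases k with _ | k
  · simp
  · rw [List.getD_cons_succ, List.getD_eq_getElem?_getD, List.getElem?_map]
    rcases p[k]? with _ | m
    · simp
    · simpa using (hc m).le

theorem costSeq_le_aux (c : M → ℝ) (cmax : ℝ) (h0 : 0 ≤ cmax) (hcmax : ∀ m, c m ≤ cmax)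
    (p : List M) (k : ℕ) : costSeq c p k ≤ cmax := by
  unfold costSeq
  rcases k with _ | k
  · simpa using h0
  · rw [List.getD_cons_succ, List.getD_eq_getElem?_getD, List.getElem?_map]
    rcases p[k]? with _ | m
    · simpa using h0
    · simpa using hcmax m

theorem costSeq_last_aux (c : M → ℝ) (m₀ : M) (p : List M) (hp : 0 < p.length) :
    costSeq c p p.length = c (p.getLastD m₀) := by
  rcases List.eq_nil_or_concat p with rfl | ⟨q, a, rfl⟩
  · simp at hp
  · simp [costSeq, List.getD_eq_getElem?_getD]

/-- (key lower bound, unequal lengths) for `γ ≥ 1`, if `|p⁻| > |p⁺|` then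
`ℒ_γ(p⁻) − ℒ_γ(p⁺) ≥ γ^{K⁺} (γ c(m⁻) − c(m⁺) − c_max ∑_{k=1}^{K⁺−1} γ^{k−K⁺})`. -/
theorem gLoss_lower_bound_unequal (c : M → ℝ) (S : M → Set M) (m₀ : M) (cmax γ : ℝ)
    (hc : ∀ m, 0 < c m) (hcmax : ∀ m, c m ≤ cmax) (hγ : 1 ≤ γ)
    (pp pm : List M) (hpp : IsPath S m₀ pp) (hpm : IsPath S m₀ pm)
    (mp mm : M) (hmp : pp.getLastD m₀ = mp) (hmm : pm.getLastD m₀ = mm)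
    (hlen : pp.length < pm.length) :
    γ ^ pp.length * (γ * c mm - c mp -
        cmax * ∑ k ∈ Finset.Icc 1 (pp.length - 1), γ ^ ((k : ℤ) - (pp.length : ℤ)))
      ≤ gLoss c γ pm - gLoss c γ pp := by
  have hγ0 : 0 < γ := by linarith
  have h0 : 0 ≤ cmax := (hc m₀).le.trans (hcmax m₀)
  have hnn : ∀ k, 0 ≤ γ ^ k * costSeq c pm k := fun k =>
    mul_nonneg (pow_nonneg hγ0.le k) (costSeq_nonneg_aux c hc pm k)
  have h1 : γ ^ pp.length * (γ * c mm) ≤ gLoss c γ pm := by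
    have hlast := costSeq_last_aux c m₀ pm (by omega)
    have hs : γ ^ pm.length * costSeq c pm pm.length ≤ gLoss c γ pm :=
      Finset.single_le_sum (f := fun k => γ ^ k * costSeq c pm k) (fun k _ => hnn k)
        (Finset.mem_Icc.mpr ⟨by omega, le_rfl⟩)
    rw [hlast, hmm] at hs
    refine le_trans ?_ hs
    rw [← mul_assoc, ← pow_succ]
    exact mul_le_mul_of_nonneg_right (pow_le_pow_right₀ hγ hlen) (hc mm).le
  have h2 : gLoss c γ pp ≤ γ ^ pp.length * c mp + cmax * (γ ^ pp.length *
      ∑ k ∈ Finset.Icc 1 (pp.length - 1), γ ^ ((k : ℤ) - (pp.length : ℤ))) := by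
    have hsum : γ ^ pp.length *
        ∑ k ∈ Finset.Icc 1 (pp.length - 1), γ ^ ((k : ℤ) - (pp.length : ℤ))
        = ∑ k ∈ Finset.Icc 1 (pp.length - 1), γ ^ k := by
      rw [Finset.mul_sum]
      refine Finset.sum_congr rfl fun k _ => ?_
      rw [zpow_sub₀ hγ0.ne', zpow_natCast, zpow_natCast]
      field_simp
    rw [hsum, Finset.mul_sum]
    rcases Nat.eq_zero_or_pos pp.length with h | h
    · have := (hc mp).le
      simpa [gLoss, h] using this
    · have hlast := costSeq_last_aux c m₀ pp h
      rw [hmp] at hlast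
      unfold gLoss
      obtain ⟨n, hn⟩ : ∃ n, pp.length = n + 1 := ⟨pp.length - 1, by omega⟩
      rw [hn] at hlast ⊢
      rw [Finset.sum_Icc_succ_top (by omega), hlast, Nat.add_sub_cancel, add_comm]
      refine add_le_add le_rfl (Finset.sum_le_sum fun k _ => ?_)
      rw [mul_comm cmax]
      exact mul_le_mul_of_nonneg_left (costSeq_le_aux c cmax h0 hcmax pp k)
        (pow_nonneg hγ0.le k)
  linarith
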